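/- arXiv:1908.08080 — 2 statements merged into one kernel-verified Lean document; each statement's English description precedes it below -/
import Mathlib

section
/- The space 𝒫_w, equipped with the metric d_w(μ₁,μ₂) = d(wμ₁, wμ₂) (d the Prokhorov metric, (wμ)(dx) = w(x)μ(dx)), is a Polish space: it is separable and complete. -/
open MeasureTheory Filter Topology
open scoped NNReal ENNReal

noncomputable section

lemma aux_scale_one {X : Type*} [MeasurableSpace X] [PseudoMetricSpace X] [OpensMeasurableSpace X]
    (P Q : Measure X) [IsProbabilityMeasure P] (a b δ C : ℝ≥0)
    (h : levyProkhorovEDist P Q < δ) (hab : a ≤ b + δ) (hb : b ≤ C) 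
    (e : ℝ≥0∞) (he : (C * δ + δ : ℝ≥0) < e) (hδ : δ < e) (het : e < ∞) (B : Set X) (hB : MeasurableSet B) :
    (a • P) B ≤ (b • Q) (Metric.thickening e.toReal B) + e := by
  have h1 := left_measure_le_of_levyProkhorovEDist_lt h hB
  have h2 : Q (Metric.thickening (δ : ℝ≥0∞).toReal B) ≤ Q (Metric.thickening e.toReal B) :=
    measure_mono (Metric.thickening_mono (ENNReal.toReal_mono het.ne hδ.le) B)
  simp only [Measure.smul_apply, ENNReal.smul_def, smul_eq_mul]
  have hab' : (a : ℝ≥0∞) ≤ b + δ := by exact_mod_cast hab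
  have hb' : (b : ℝ≥0∞) ≤ C := by exact_mod_cast hb
  push_cast at he
  calc (a : ℝ≥0∞) * P B ≤ (b + δ) * P B := by gcongr
    _ = b * P B + δ * P B := by ring
    _ ≤ b * (Q (Metric.thickening e.toReal B) + δ) + δ * 1 := by
        gcongr
        · exact h1.trans (by gcongr)
        · exact prob_le_one
    _ = b * Q (Metric.thickening e.toReal B) + (b * δ + δ) := by ring
    _ ≤ b * Q (Metric.thickening e.toReal B) + (C * δ + δ) := by gcongr
    _ ≤ _ := by gcongr

lemma aux_scale {X : Type*} [MeasurableSpace X] [PseudoMetricSpace X] [OpensMeasurableSpace X]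
    (P Q : Measure X) [IsProbabilityMeasure P] [IsProbabilityMeasure Q] (a b δ C : ℝ≥0)
    (h : levyProkhorovEDist P Q < δ) (hab : a ≤ b + δ) (hba : b ≤ a + δ) (ha : a ≤ C) (hb : b ≤ C) :
    levyProkhorovEDist (a • P) (b • Q) ≤ (C * δ + δ : ℝ≥0) := by
  refine levyProkhorovEDist_le_of_forall _ _ _ fun e B he het hB => ?_
  have hδ : (δ : ℝ≥0∞) < e := lt_of_le_of_lt (by exact_mod_cast le_add_self) he
  exact ⟨aux_scale_one P Q a b δ C h hab hb e he hδ het B hB,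
    aux_scale_one Q P b a δ C (by rwa [levyProkhorovEDist_comm]) hba ha e he hδ het B hB⟩

lemma aux_code_one {X : Type*} [MeasurableSpace X] [PseudoMetricSpace X]
    (A : ℕ → Set X) (hA : ∀ n, MeasurableSet (A n)) (hAb : ∀ n, Bornology.IsBounded (A n)) (r : ℝ≥0)
    (hAd : ∀ n, Metric.diam (A n) ≤ r) (hAu : ⋃ n, A n = Set.univ)
    (hAp : Pairwise (fun (n m : ℕ) ↦ Disjoint (A n) (A m)))
    (μ ν : Measure X) (n : ℕ) (hn : μ (⋃ i ≥ n, A i) ≤ r)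
    (hμν : ∀ i < n, μ (A i) ≤ ν (A i) + r / (n + 1)) (e : ℝ≥0∞) (he : 2 * (r : ℝ≥0∞) ≤ e)
    (hr : (r : ℝ≥0∞) < e) (het : e < ∞) (B : Set X) :
    μ B ≤ ν (Metric.thickening e.toReal B) + e := by
  classical
  set I := (Finset.range n).filter (fun i => (A i ∩ B).Nonempty)
  have hsub : B ⊆ (⋃ i ∈ I, A i) ∪ (⋃ i ≥ n, A i) := by
    intro x hx
    have : x ∈ ⋃ n, A n := by rw [hAu]; trivial
    obtain ⟨i, hi⟩ := Set.mem_iUnion.1 this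
    rcases lt_or_ge i n with h | h
    · left
      simp only [Set.mem_iUnion]
      exact ⟨i, by simp only [I, Finset.mem_filter, Finset.mem_range]; exact ⟨h, x, hi, hx⟩, hi⟩
    · right
      simp only [Set.mem_iUnion]
      exact ⟨i, h, hi⟩
  have hthick : (⋃ i ∈ I, A i) ⊆ Metric.thickening e.toReal B := by
    intro x hx
    simp only [Set.mem_iUnion] at hx
    obtain ⟨i, hi, hx⟩ := hx
    simp only [I, Finset.mem_filter, Finset.mem_range] at hi
    obtain ⟨-, y, hy, hyB⟩ := hi
    rw [Metric.mem_thickening_iff]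
    refine ⟨y, hyB, ?_⟩
    have h1 := Metric.dist_le_diam_of_mem (hAb i) hx hy
    have h2 : (r : ℝ) < e.toReal := by
      have := (ENNReal.toReal_lt_toReal (by simp) het.ne).2 hr
      simpa using this
    linarith [hAd i]
  have hsum : ∑ i ∈ I, ν (A i) = ν (⋃ i ∈ I, A i) :=
    (measure_biUnion_finset (fun i _ j _ hij => hAp hij) (fun i _ => hA i)).symm
  have hcard : (I.card : ℝ≥0∞) * (r / (n + 1)) ≤ r := by
    have : (I.card : ℝ≥0∞) ≤ n + 1 := by
      have : I.card ≤ n := (Finset.card_filter_le _ _).trans (by simp)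
      exact_mod_cast this.trans (Nat.le_succ n)
    calc (I.card : ℝ≥0∞) * (r / (n + 1)) ≤ (n + 1) * (r / (n + 1)) := by gcongr
      _ ≤ r := ENNReal.mul_div_le
  calc μ B ≤ μ (⋃ i ∈ I, A i) + μ (⋃ i ≥ n, A i) := (measure_mono hsub).trans (measure_union_le _ _)
    _ ≤ ∑ i ∈ I, μ (A i) + r := by gcongr; exact measure_biUnion_finset_le _ _
    _ ≤ ∑ i ∈ I, (ν (A i) + r / (n + 1)) + r := by
        gcongr with i hi
        exact hμν i (by simpa using (Finset.mem_filter.1 hi).1)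
    _ = ν (⋃ i ∈ I, A i) + I.card * (r / (n + 1)) + r := by
        rw [Finset.sum_add_distrib, hsum]; simp
    _ ≤ ν (Metric.thickening e.toReal B) + r + r := by gcongr
    _ = ν (Metric.thickening e.toReal B) + 2 * r := by ring
    _ ≤ _ := by gcongr

lemma aux_floor (x y c : ℝ) (hc : 0 < c) (hx : 0 ≤ x) (hy : 0 ≤ y) (h : ⌊x * c⌋₊ = ⌊y * c⌋₊) :
    x ≤ y + 1 / c := by
  have h1 := Nat.lt_floor_add_one (x * c)
  have h2 := Nat.floor_le (mul_nonneg hy hc.le)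
  rw [h] at h1
  have : x * c ≤ (y + 1 / c) * c := by field_simp; linarith
  exact le_of_mul_le_mul_right this hc

lemma aux_code {X : Type*} [MeasurableSpace X] [PseudoMetricSpace X] [OpensMeasurableSpace X]
    [TopologicalSpace.SeparableSpace X] (r : ℝ≥0) (hr : 0 < r) :
    ∃ code : Measure X → Σ n : ℕ, (Fin n → ℕ), ∀ μ ν : Measure X, IsFiniteMeasure μ →
      IsFiniteMeasure ν → code μ = code ν → levyProkhorovEDist μ ν ≤ 2 * r := by
  classical
  obtain ⟨A, hA, hAb, hAd, hAu, hAp⟩ :=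
    SeparableSpace.exists_measurable_partition_diam_le X (ε := r) (by exact_mod_cast hr)
  have key : ∀ μ : Measure X, IsFiniteMeasure μ → ∃ n : ℕ, μ (⋃ i ≥ n, A i) ≤ r := by
    intro μ hμ
    have := tendsto_measure_biUnion_Ici_zero_of_pairwise_disjoint (μ := μ)
      (fun i => (hA i).nullMeasurableSet) hAp
    have h2 := this.eventually_le_const (u := (r : ℝ≥0∞)) (by exact_mod_cast hr)
    obtain ⟨n, hn⟩ := h2.exists
    exact ⟨n, hn⟩
  let N : Measure X → ℕ := fun μ => if h : IsFiniteMeasure μ then (key μ h).choose else 0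
  have hN : ∀ μ : Measure X, IsFiniteMeasure μ → μ (⋃ i ≥ N μ, A i) ≤ r := by
    intro μ hμ
    simp only [N, dif_pos hμ]
    exact (key μ hμ).choose_spec
  have main : ∀ μ ν : Measure X, IsFiniteMeasure μ → IsFiniteMeasure ν → ∀ n, 
     (∀ i < n, ⌊μ.real (A i) * ((n + 1) / r)⌋₊ = ⌊ν.real (A i) * ((n + 1) / r)⌋₊) →
      ∀ i < n, μ (A i) ≤ ν (A i) + r / (n + 1) := by
    intro μ ν hμ hν n h i hi
    have hr' : (0 : ℝ) < r := by exact_mod_cast hr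
    have := aux_floor _ _ ((n + 1) / r) (by positivity) measureReal_nonneg measureReal_nonneg (h i hi)
    have h3 := ENNReal.ofReal_le_ofReal this
    rw [ENNReal.ofReal_add measureReal_nonneg (by positivity), ofReal_measureReal,
      ofReal_measureReal, one_div_div, ENNReal.ofReal_div_of_pos (by positivity),
      ENNReal.ofReal_coe_nnreal] at h3
    convert h3 using 3
    rw [ENNReal.ofReal_add (by positivity) (by positivity)]
    simp
  refine ⟨fun μ => ⟨N μ, fun i => ⌊μ.real (A i) * ((N μ + 1) / r)⌋₊⟩, ?_⟩
  intro μ ν hμ hν hcode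
  rw [Sigma.mk.injEq] at hcode
  obtain ⟨h1, h2⟩ := hcode
  have h3 : ∀ i < N μ, ⌊μ.real (A i) * ((N μ + 1) / r)⌋₊ = ⌊ν.real (A i) * ((N μ + 1) / r)⌋₊ := by
    intro i hi
    have hN2 := hN ν hν
    revert h2 
    rw [← h1]
    intro h2
    exact congrFun (eq_of_heq h2) ⟨i, hi⟩
  refine levyProkhorovEDist_le_of_forall _ _ _ fun e B he het hB => ?_
  have hre : (r : ℝ≥0∞) < e := lt_of_le_of_lt (by rw [two_mul]; exact le_self_add) he
  constructor
  · exact aux_code_one A hA hAb r hAd hAu hAp μ ν (N μ) (hN μ hμ) (main μ ν hμ hν _ h3) e he.le hre het B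
  · exact aux_code_one A hA hAb r hAd hAu hAp ν μ (N μ) (by rw [h1]; exact hN ν hν)
      (main ν μ hν hμ _ (fun i hi => (h3 i hi).symm)) e he.le hre het B

lemma aux_edist_lt {X : Type*} [MeasurableSpace X] [PseudoMetricSpace X]
    (μ ν : Measure X) [IsFiniteMeasure μ] [IsFiniteMeasure ν] (r : ℝ≥0)
    (h : levyProkhorovDist μ ν < r) : levyProkhorovEDist μ ν < r := by
  rw [levyProkhorovDist] at h
  rw [← ENNReal.toReal_lt_toReal (by simp) (by simp)]
  simpa using h

lemma aux_mass {X : Type*} [MeasurableSpace X] [PseudoMetricSpace X] [OpensMeasurableSpace X]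
    (μ ν : FiniteMeasure X) (r : ℝ≥0)
    (h : levyProkhorovEDist (μ : Measure X) (ν : Measure X) < r) : μ.mass ≤ ν.mass + r := by
  have h1 := left_measure_le_of_levyProkhorovEDist_lt h MeasurableSet.univ
  have h2 : (μ : Measure X) Set.univ ≤ (ν : Measure X) Set.univ + r :=
    h1.trans (by gcongr; exact Set.subset_univ _)
  rw [← FiniteMeasure.ennreal_mass, ← FiniteMeasure.ennreal_mass] at h2
  exact_mod_cast h2

lemma aux_tight {X : Type*} [MeasurableSpace X] [MetricSpace X] [BorelSpace X] [ProperSpace X]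
    (ν : ℕ → FiniteMeasure X)
    (hc : ∀ r : ℝ≥0, 0 < r → ∃ N, ∀ m ≥ N, ∀ n ≥ N,
      levyProkhorovEDist (ν m : Measure X) (ν n : Measure X) < r) (r : ℝ≥0) (hr : 0 < r) :
    ∃ K : Set X, IsCompact K ∧ ∀ n, (ν n : Measure X) Kᶜ ≤ 2 * r := by
  have hs : ∀ n, ∃ K : Set X, IsCompact K ∧ (ν n : Measure X) Kᶜ ≤ r := by
    intro n
    have h := isTightMeasureSet_singleton (μ := (ν n : Measure X))
    rw [isTightMeasureSet_iff_exists_isCompact_measure_compl_le] at h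
    obtain ⟨K, hK, h⟩ := h r (by exact_mod_cast hr)
    exact ⟨K, hK, h _ rfl⟩
  choose K hK hKν using hs
  obtain ⟨N, hN⟩ := hc r hr
  refine ⟨(⋃ i ∈ Finset.range N, K i) ∪ Metric.cthickening r (K N), ?_, fun n => ?_⟩
  · exact ((Finset.range N).isCompact_biUnion (fun i _ => hK i)).union (hK N).cthickening
  rcases lt_or_ge n N with h | h
  · calc (ν n : Measure X) _ ≤ (ν n : Measure X) (K n)ᶜ := by
          apply measure_mono
          apply Set.compl_subset_compl.2
          refine Set.Subset.trans ?_ Set.subset_union_left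
          exact Set.subset_biUnion_of_mem (u := K) (by simpa using h)
      _ ≤ r := hKν n
      _ ≤ 2 * r := by rw [two_mul]; exact le_self_add
  · have h1 := left_measure_le_of_levyProkhorovEDist_lt (hN n h N le_rfl)
      (B := (Metric.thickening r (K N))ᶜ) Metric.isOpen_thickening.measurableSet.compl
    calc (ν n : Measure X) _ ≤ (ν n : Measure X) (Metric.thickening r (K N))ᶜ := by
          apply measure_mono
          apply Set.compl_subset_compl.2
          exact (Metric.thickening_subset_cthickening _ _).trans Set.subset_union_right
      _ ≤ _ := h1
      _ ≤ (ν N : Measure X) (K N)ᶜ + r := by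
          gcongr
          rw [Set.subset_compl_comm]
          simpa using Metric.subset_compl_thickening_compl_thickening_self (r : ℝ) (K N)
      _ ≤ r + r := by gcongr; exact hKν N
      _ = 2 * r := (two_mul _).symm

lemma aux_complete {X : Type*} [MeasurableSpace X] [MetricSpace X] [BorelSpace X] [ProperSpace X]
    [Nonempty X] (ν : ℕ → FiniteMeasure X) (h1 : ∀ n, 1 ≤ (ν n).mass)
    (hc : ∀ ε : ℝ, 0 < ε → ∃ N, ∀ m ≥ N, ∀ n ≥ N,
      levyProkhorovDist (ν m : Measure X) (ν n : Measure X) < ε) :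
    ∃ (ν' : FiniteMeasure X) (φ : ℕ → ℕ), Tendsto (ν ∘ φ) atTop (𝓝 ν') ∧
      Tendsto (fun n => levyProkhorovDist (ν n : Measure X) (ν' : Measure X)) atTop (𝓝 0) := by
  have hc' : ∀ r : ℝ≥0, 0 < r → ∃ N, ∀ m ≥ N, ∀ n ≥ N,
      levyProkhorovEDist (ν m : Measure X) (ν n : Measure X) < r := by
    intro r hr
    obtain ⟨N, hN⟩ := hc r (by exact_mod_cast hr)
    exact ⟨N, fun m hm n hn => aux_edist_lt _ _ _ (hN m hm n hn)⟩
  -- masses converge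
  have hmass : CauchySeq (fun n => (ν n).mass) := by
    rw [Metric.cauchySeq_iff]
    intro ε hε
    lift ε to ℝ≥0 using hε.le
    have hε' : 0 < ε := by exact_mod_cast hε
    obtain ⟨N, hN⟩ := hc' (ε / 2) (by positivity)
    refine ⟨N, fun m hm n hn => ?_⟩
    have a1 : ((ν m).mass : ℝ) ≤ (ν n).mass + ε / 2 := by
      exact_mod_cast aux_mass _ _ _ (hN m hm n hn)
    have a2 : ((ν n).mass : ℝ) ≤ (ν m).mass + ε / 2 := by
      exact_mod_cast aux_mass _ _ _ (hN n hn m hm)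
    rw [NNReal.dist_eq]
    refine lt_of_le_of_lt (abs_le.2 ⟨?_, ?_⟩) (half_lt_self hε) <;> linarith
  obtain ⟨a, ha⟩ := cauchySeq_tendsto_of_complete hmass
  -- tightness
  have htight : IsTightMeasureSet {((μ : ProbabilityMeasure X) : Measure X) |
      μ ∈ Set.range (fun n => (ν n).normalize)} := by
    rw [isTightMeasureSet_iff_exists_isCompact_measure_compl_le]
    intro ε hε
    obtain ⟨r, hr, hrε⟩ := ENNReal.lt_iff_exists_nnreal_btwn.1 hε
    have hr' : 0 < r := by exact_mod_cast hr
    obtain ⟨K, hK, h⟩ := aux_tight ν hc' (r / 2) (by positivity)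
    refine ⟨K, hK, ?_⟩
    rintro _ ⟨_, ⟨n, rfl⟩, rfl⟩
    have hne : ν n ≠ 0 := by
      rw [← (ν n).mass_nonzero_iff]
      exact (lt_of_lt_of_le one_pos (h1 n)).ne'
    simp only
    rw [(ν n).toMeasure_normalize_eq_of_nonzero hne, Measure.smul_apply, ENNReal.smul_def, smul_eq_mul]
    have hinv : (((ν n).mass⁻¹ : ℝ≥0) : ℝ≥0∞) ≤ 1 := by exact_mod_cast inv_le_one_of_one_le₀ (h1 n)
    calc _ ≤ 1 * (ν n : Measure X) Kᶜ := by gcongr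
      _ ≤ 2 * ((r / 2 : ℝ≥0) : ℝ≥0∞) := by rw [one_mul]; exact h n
      _ = r := by exact_mod_cast (by field_simp : 2 * (r / 2) = r)
      _ ≤ ε := hrε.le
  have hcomp := isCompact_closure_of_isTightMeasureSet htight
  obtain ⟨P, -, φ, hφ, hP⟩ := hcomp.tendsto_subseq
    (x := fun n => (ν n).normalize) (fun n => subset_closure ⟨n, rfl⟩)
  have haφ := ha.comp hφ.tendsto_atTop
  refine ⟨a • P.toFiniteMeasure, φ, ?_, ?_⟩
  · have hP2 := (ProbabilityMeasure.tendsto_nhds_iff_toFiniteMeasure_tendsto_nhds _).1 hP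
    have := haφ.smul hP2
    refine this.congr fun n => ?_
    exact ((ν (φ n)).self_eq_mass_smul_normalize).symm
  · have hLP : Tendsto (fun n => levyProkhorovDist ((ν (φ n)).normalize : Measure X) (P : Measure X))
        atTop (𝓝 0) := by
      have := (LevyProkhorov.continuous_ofMeasure_probabilityMeasure (Ω := X)).tendsto P |>.comp hP
      rw [tendsto_iff_dist_tendsto_zero] at this
      exact this
    have hsub : Tendsto (fun n => LevyProkhorov.ofMeasure (ν (φ n))) atTop
        (𝓝 (LevyProkhorov.ofMeasure (a • P.toFiniteMeasure))) := by
      rw [Metric.tendsto_nhds]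
      intro ε hε
      lift ε to ℝ≥0 using hε.le
      have hε' : 0 < ε := by exact_mod_cast hε
      set C := a + 1
      set δ := min 1 (ε / (2 * (C + 1)))
      have hδ : 0 < δ := lt_min one_pos (by positivity)
      have e1 := hLP.eventually_lt_const (u := (δ : ℝ)) (by exact_mod_cast hδ)
      have e2 := (Metric.tendsto_nhds.1 haφ) δ (by exact_mod_cast hδ)
      filter_upwards [e1, e2] with n b1 b2
      rw [LevyProkhorov.dist_finiteMeasure_def]
      simp only [Function.comp] at b2
      rw [NNReal.dist_eq, abs_lt] at b2
      have c1 : (ν (φ n)).mass ≤ a + δ := by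
        rw [← NNReal.coe_le_coe]; push_cast; linarith
      have c2 : a ≤ (ν (φ n)).mass + δ := by
        rw [← NNReal.coe_le_coe]; push_cast; linarith
      have := aux_scale ((ν (φ n)).normalize : Measure X) (P : Measure X) (ν (φ n)).mass a δ C
        (aux_edist_lt _ _ _ b1) c1 c2 (c1.trans (add_le_add le_rfl (min_le_left _ _))) le_self_add
      have heq : ((ν (φ n)).mass • ((ν (φ n)).normalize : Measure X)) = ν (φ n) := by
        have := congrArg (fun μ : FiniteMeasure X => (μ : Measure X)) (ν (φ n)).self_eq_mass_smul_normalize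
        exact this.symm
      rw [heq] at this
      have h3 := ENNReal.toReal_mono ENNReal.coe_ne_top this
      have h4 : C * δ + δ < ε := by
        calc C * δ + δ = (C + 1) * δ := by ring
          _ ≤ (C + 1) * (ε / (2 * (C + 1))) := by gcongr; exact min_le_right _ _
          _ = ε / 2 := by field_simp
          _ < ε := NNReal.half_lt_self hε'.ne'
      refine lt_of_le_of_lt h3 ?_
      exact_mod_cast h4
    have hcau : CauchySeq (fun n => LevyProkhorov.ofMeasure (ν n)) := by
      rw [Metric.cauchySeq_iff]
      exact hc
    have := tendsto_nhds_of_cauchySeq_of_subseq hcau hφ.tendsto_atTop hsub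
    rw [tendsto_iff_dist_tendsto_zero] at this
    exact this

lemma aux_sep {α β : Type*} [Countable β] (p : α → Prop) (code : ℕ → α → β) :
    ∃ S : Set α, S.Countable ∧ (∀ x ∈ S, p x) ∧
      ∀ x, p x → ∀ k, ∃ y ∈ S, p y ∧ code k x = code k y := by
  classical
  refine ⟨⋃ kb : ℕ × β, {y | ∃ h : ∃ z, p z ∧ code kb.1 z = kb.2, y = h.choose}, ?_, ?_, ?_⟩
  · refine Set.countable_iUnion fun kb => Set.Subsingleton.countable ?_
    rintro x ⟨h, rfl⟩ y ⟨h', rfl⟩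
    rfl
  · intro x hx
    simp only [Set.mem_iUnion] at hx
    obtain ⟨kb, h, rfl⟩ := hx
    exact h.choose_spec.1
  · intro x hx k
    have h : ∃ z, p z ∧ code k z = code k x := ⟨x, hx, rfl⟩
    refine ⟨h.choose, ?_, h.choose_spec.1, h.choose_spec.2.symm⟩
    simp only [Set.mem_iUnion]
    exact ⟨(k, code k x), h, rfl⟩

/-- The space `𝒫_w`, equipped with the metric
`d_w(μ₁,μ₂) = d(wμ₁, wμ₂)` (`d` the Prokhorov metric, `(wμ)(dx) = w(x)μ(dx)`),
is a Polish space: it is separable and complete. -/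
theorem stmt_1 {d : ℕ} (w : EuclideanSpace ℝ (Fin d) → ℝ)
    (hw_smooth : ContDiff ℝ (⊤ : ℕ∞) w) (hw_one : ∀ x, 1 ≤ w x)
    (hw_infty : Tendsto w (cocompact (EuclideanSpace ℝ (Fin d))) atTop)
    (E : Set (EuclideanSpace ℝ (Fin d))) (hE_closed : IsClosed E) (hE_noncompact : ¬ IsCompact E)
    (Pw : Set (Measure E))
    (hPw : Pw = {μ : Measure E | IsProbabilityMeasure μ ∧ Integrable (fun x : E => w x.1) μ})
    (dw : Measure E → Measure E → ℝ)
    (hdw : ∀ μ ν : Measure E, dw μ ν =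
      levyProkhorovDist
        (μ.withDensity (fun x => ENNReal.ofReal (w x.1)))
        (ν.withDensity (fun x => ENNReal.ofReal (w x.1)))) :
    -- separability of `(𝒫_w, d_w)`:
    (∃ S : Set (Measure E), S.Countable ∧ S ⊆ Pw ∧
      ∀ μ ∈ Pw, ∀ ε : ℝ, 0 < ε → ∃ ν ∈ S, dw μ ν < ε) ∧
    -- completeness of `(𝒫_w, d_w)`:
    (∀ μs : ℕ → Measure E, (∀ n, μs n ∈ Pw) →
      (∀ ε : ℝ, 0 < ε → ∃ N, ∀ m ≥ N, ∀ n ≥ N, dw (μs m) (μs n) < ε) →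
      ∃ μ ∈ Pw, Tendsto (fun n => dw (μs n) μ) atTop (𝓝 0)) := by
  have hwc : Continuous (fun x : E => w x.1) := hw_smooth.continuous.comp continuous_subtype_val
  have hpos : ∀ x, 0 < w x := fun x => lt_of_lt_of_le one_pos (hw_one x)
  have hne : Nonempty E := by
    by_contra h
    rw [Set.nonempty_coe_sort, Set.not_nonempty_iff_eq_empty] at h
    exact hE_noncompact (h ▸ isCompact_empty)
  have hproper : ProperSpace E := ProperSpace.of_isClosed hE_closed
  set f : E → ℝ≥0∞ := fun x => ENNReal.ofReal (w x.1) with hf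
  have hfm : Measurable f := hwc.measurable.ennreal_ofReal
  have hfin : ∀ μ ∈ Pw, IsFiniteMeasure (μ.withDensity f) := by
    intro μ hμ
    rw [hPw] at hμ
    exact isFiniteMeasure_withDensity_ofReal hμ.2.2
  constructor
  · have hcode := fun k : ℕ => aux_code (X := E) (1 / (k + 1 : ℝ≥0)) (by positivity)
    choose code hcode using hcode
    obtain ⟨S, hS, hSP, h⟩ := aux_sep (fun μ => μ ∈ Pw) (fun k μ => code k (μ.withDensity f))
    refine ⟨S, hS, hSP, fun μ hμ ε hε => ?_⟩
    obtain ⟨k, hk⟩ := exists_nat_one_div_lt (half_pos hε)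
    obtain ⟨ν, hνS, hν, hc⟩ := h μ hμ k
    refine ⟨ν, hνS, ?_⟩
    have := hcode k _ _ (hfin μ hμ) (hfin ν hν) hc
    have h3 := ENNReal.toReal_mono (by finiteness) this
    rw [hdw]
    refine lt_of_le_of_lt h3 ?_
    rw [ENNReal.toReal_mul]
    simp only [ENNReal.toReal_ofNat, ENNReal.coe_toReal]
    push_cast
    linarith
  · intro μs hμs hcau
    set ν : ℕ → FiniteMeasure E := fun n => ⟨(μs n).withDensity f, hfin _ (hμs n)⟩ with hν
    have hP : ∀ n, IsProbabilityMeasure (μs n) := fun n => by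
      have := hμs n
      rw [hPw] at this
      exact this.1
    have hmass : ∀ n, 1 ≤ (ν n).mass := by
      intro n
      rw [← ENNReal.coe_le_coe, FiniteMeasure.ennreal_mass]
      change _ ≤ (μs n).withDensity f Set.univ
      rw [withDensity_apply _ MeasurableSet.univ, Measure.restrict_univ]
      calc ((1 : ℝ≥0) : ℝ≥0∞) = ∫⁻ _, 1 ∂(μs n) := by simp
        _ ≤ _ := by
          apply lintegral_mono
          intro x
          simpa [f] using hw_one x.1
    obtain ⟨ν', φ, hφ, hlim⟩ := aux_complete ν hmass (by
      intro ε hε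
      obtain ⟨N, hN⟩ := hcau ε hε
      refine ⟨N, fun m hm n hn => ?_⟩
      have := hN m hm n hn
      rwa [hdw] at this)
    let g : BoundedContinuousFunction E ℝ≥0 := BoundedContinuousFunction.mkOfBound
      ⟨fun x => (Real.toNNReal (w x.1))⁻¹, by
        refine Continuous.inv₀ (continuous_real_toNNReal.comp hwc) fun x => ?_
        simpa using hpos x.1⟩ 1 (by
        intro x y
        have hb : ∀ z : E, ((Real.toNNReal (w z.1))⁻¹ : ℝ≥0) ≤ 1 := fun z =>
          inv_le_one_of_one_le₀ (by simpa using hw_one z.1)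
        have hx : (((Real.toNNReal (w x.1))⁻¹ : ℝ≥0) : ℝ) ≤ 1 := by exact_mod_cast hb x
        have hy : (((Real.toNNReal (w y.1))⁻¹ : ℝ≥0) : ℝ) ≤ 1 := by exact_mod_cast hb y
        have hx0 := NNReal.coe_nonneg (Real.toNNReal (w x.1))⁻¹
        have hy0 := NNReal.coe_nonneg (Real.toNNReal (w y.1))⁻¹
        rw [NNReal.dist_eq]
        simp only [ContinuousMap.coe_mk]
        rw [abs_le]
        constructor <;> linarith)
    have hgf : ∀ x, (g x : ℝ≥0∞) * f x = 1 := by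
      intro x
      have : f x = ((Real.toNNReal (w x.1) : ℝ≥0) : ℝ≥0∞) := rfl
      rw [this]
      change (((Real.toNNReal (w x.1))⁻¹ : ℝ≥0) : ℝ≥0∞) * _ = 1
      rw [← ENNReal.coe_mul, inv_mul_cancel₀ (by simpa using hpos x.1), ENNReal.coe_one]
    have hgm : Measurable (fun x => (g x : ℝ≥0∞)) := g.continuous.measurable.coe_nnreal_ennreal
    have hg1 : ∀ n, ∫⁻ x, (g x : ℝ≥0∞) ∂(ν n : Measure E) = 1 := by
      intro n
      change ∫⁻ x, (g x : ℝ≥0∞) ∂((μs n).withDensity f) = 1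
      rw [lintegral_withDensity_eq_lintegral_mul _ hfm hgm]
      simp only [Pi.mul_apply, mul_comm (f _), hgf]
      simp
    have hg' : ∫⁻ x, (g x : ℝ≥0∞) ∂(ν' : Measure E) = 1 := by
      have := FiniteMeasure.tendsto_iff_forall_lintegral_tendsto.1 hφ g
      simp only [Function.comp, hg1] at this
      exact tendsto_nhds_unique this tendsto_const_nhds
    set μ := (ν' : Measure E).withDensity (fun x => (g x : ℝ≥0∞)) with hμ
    have hμν : μ.withDensity f = ν' := by
      rw [hμ, ← withDensity_mul _ hgm hfm]
      have : ((fun x => (g x : ℝ≥0∞)) * f) = 1 := by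
        funext x; exact hgf x
      rw [this, withDensity_one]
    refine ⟨μ, ?_, ?_⟩
    · rw [hPw]
      refine ⟨⟨?_⟩, ?_⟩
      · rw [hμ, withDensity_apply _ MeasurableSet.univ, Measure.restrict_univ, hg']
      · refine ⟨hwc.measurable.aestronglyMeasurable, ?_⟩
        rw [hasFiniteIntegral_iff_ofReal (f := fun x : E => w x.1)
          (Eventually.of_forall fun x : E => (hpos x.1).le)]
        have : ∫⁻ x, f x ∂μ = (ν' : Measure E) Set.univ := by
          rw [← hμν, withDensity_apply _ MeasurableSet.univ, Measure.restrict_univ]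
        change ∫⁻ x, f x ∂μ < ∞
        rw [this]
        exact measure_lt_top _ _
    · refine hlim.congr fun n => ?_
      rw [hdw, hμν]
      rfl
end
end

section
/- Let E = ℝ and let φ : ℝ → ℝ be continuous. The function f(μ) = ⟨φ,μ⟩ e^{-⟨w,μ⟩} on 𝒫_w is of C₀ type if and only if φ(x)/w(x) converges to a finite limit as |x| → ∞. -/
open MeasureTheory Filter Topology
open scoped NNReal ENNReal ZeroAtInfty

noncomputable section

instance (X : Type*) [TopologicalSpace X] : MeasurableSpace (OnePoint X) := borel _
instance (X : Type*) [TopologicalSpace X] : BorelSpace (OnePoint X) := ⟨rfl⟩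

/-- `w⁻¹` extended to `ℝ^Δ = ℝ ∪ {Δ}` by `w⁻¹(Δ) = 0`. -/
def winvOP (w : ℝ → ℝ) : OnePoint ℝ → ℝ := fun z => z.elim 0 (fun y => (w y)⁻¹)

/-- The state space `𝒳 = {ν ∈ M_+(ℝ^Δ) : ⟨w⁻¹,ν⟩ = 1}`, as a subtype of the space of finite
measures on `ℝ^Δ` with the topology of weak convergence. -/
def XSp (w : ℝ → ℝ) : Type :=
  {ν : FiniteMeasure (OnePoint ℝ) //
    (∫⁻ x, ENNReal.ofReal (winvOP w x) ∂(ν : Measure (OnePoint ℝ))) = 1}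

instance (w : ℝ → ℝ) : TopologicalSpace (XSp w) :=
  instTopologicalSpaceSubtype

theorem opExt_cont (g : ℝ → ℝ) (hg : Continuous g) (l : ℝ)
    (h : Tendsto g (cocompact ℝ) (𝓝 l)) :
    Continuous (fun z : OnePoint ℝ => (z.elim l g : ℝ)) := by
  rw [OnePoint.continuous_iff]
  refine ⟨?_, ?_⟩
  · rw [Filter.coclosedCompact_eq_cocompact]
    exact h
  · exact hg

theorem winv_cont (w : ℝ → ℝ) (hwc : Continuous w) (hw_one : ∀ x, 1 ≤ w x)
    (hw_infty : Tendsto w (cocompact ℝ) atTop) : Continuous (winvOP w) :=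
  opExt_cont _ (hwc.inv₀ fun x => by linarith [hw_one x]) 0 (tendsto_inv_atTop_zero.comp hw_infty)

theorem winv_nonneg (w : ℝ → ℝ) (hw_one : ∀ x, 1 ≤ w x) (z : OnePoint ℝ) : 0 ≤ winvOP w z := by
  induction z using OnePoint.rec with
  | infty => exact le_refl (0:ℝ)
  | coe x => exact inv_nonneg.2 (by linarith [hw_one x])

theorem winv_le (w : ℝ → ℝ) (hw_one : ∀ x, 1 ≤ w x) (z : OnePoint ℝ) : winvOP w z ≤ 1 := by
  induction z using OnePoint.rec with
  | infty => exact zero_le_one (α := ℝ)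
  | coe x => exact inv_le_one_of_one_le₀ (hw_one x)

theorem int_cont (g : OnePoint ℝ → ℝ) (hg : Continuous g) :
    Continuous (fun ν : FiniteMeasure (OnePoint ℝ) => ∫ x, g x ∂(ν : Measure (OnePoint ℝ))) := by
  rw [continuous_iff_continuousAt]
  intro ν
  exact (FiniteMeasure.tendsto_iff_forall_integral_tendsto.1 (tendsto_id (x := 𝓝 ν)))
    (BoundedContinuousFunction.mkOfCompact ⟨g, hg⟩)

theorem int_able (g : OnePoint ℝ → ℝ) (hg : Continuous g) (ν : Measure (OnePoint ℝ))
    [IsFiniteMeasure ν] : Integrable g ν :=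
  (BoundedContinuousFunction.mkOfCompact ⟨g, hg⟩).integrable ν

theorem XSp_iff (w : ℝ → ℝ) (hc : Continuous (winvOP w)) (hw_one : ∀ x, 1 ≤ w x)
    (ν : FiniteMeasure (OnePoint ℝ)) :
    (∫⁻ x, ENNReal.ofReal (winvOP w x) ∂(ν : Measure (OnePoint ℝ))) = 1 ↔
      ∫ x, winvOP w x ∂(ν : Measure (OnePoint ℝ)) = 1 := by
  rw [← ofReal_integral_eq_lintegral_ofReal (int_able _ hc _)
    (Eventually.of_forall (winv_nonneg w hw_one)), ENNReal.ofReal_eq_one]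

theorem XSp_emb (w : ℝ → ℝ) (hc : Continuous (winvOP w)) (hw_one : ∀ x, 1 ≤ w x) :
    IsClosedEmbedding (fun ν : XSp w => ν.1) := by
  have : IsClosed {ν : FiniteMeasure (OnePoint ℝ) |
      (∫⁻ x, ENNReal.ofReal (winvOP w x) ∂(ν : Measure (OnePoint ℝ))) = 1} := by
    simp_rw [XSp_iff w hc hw_one]
    exact isClosed_eq (int_cont _ hc) continuous_const
  exact this.isClosedEmbedding_subtypeVal

theorem mass_tend (w : ℝ → ℝ) (hc : Continuous (winvOP w)) (hw_one : ∀ x, 1 ≤ w x) :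
    Tendsto (fun ν : XSp w => (ν.1.mass : ℝ)) (cocompact (XSp w)) atTop := by
  rw [tendsto_atTop]
  intro C
  have h1 := (XSp_emb w hc hw_one).isCompact_preimage
    (isCompact_setOfPred_finiteMeasure_le_of_compactSpace (OnePoint ℝ) C.toNNReal)
  filter_upwards [h1.compl_mem_cocompact] with ν hν
  have : ¬ (ν.1.mass ≤ C.toNNReal) := hν
  push Not at this
  exact (Real.toNNReal_le_iff_le_coe).1 this.le

theorem exF (w : ℝ → ℝ) (hc : Continuous (winvOP w)) (hw_one : ∀ x, 1 ≤ w x)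
    (g : OnePoint ℝ → ℝ) (hg : Continuous g) :
    ∃ F : C₀(XSp w, ℝ), ∀ ν : XSp w,
      F ν = (∫ x, g x ∂(ν.1 : Measure (OnePoint ℝ))) * Real.exp (-(ν.1.mass : ℝ)) := by
  have hv : Continuous (fun ν : XSp w => ν.1) := (XSp_emb w hc hw_one).continuous
  refine ⟨⟨⟨fun ν => (∫ x, g x ∂(ν.1 : Measure (OnePoint ℝ))) * Real.exp (-(ν.1.mass : ℝ)), ?_⟩,
    ?_⟩, fun ν => rfl⟩
  · refine ((int_cont g hg).comp hv).mul (Real.continuous_exp.comp ?_)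
    exact (NNReal.continuous_coe.comp (FiniteMeasure.continuous_mass.comp hv)).neg
  · obtain ⟨K, hK⟩ : ∃ K, ∀ x, ‖g x‖ ≤ K :=
      ⟨_, (BoundedContinuousFunction.mkOfCompact ⟨g, hg⟩).norm_coe_le_norm⟩
    have h2 : Tendsto (fun ν : XSp w => K * ((ν.1.mass : ℝ) ^ 1 * Real.exp (-(ν.1.mass : ℝ))))
        (cocompact (XSp w)) (𝓝 0) := by
      simpa using ((Real.tendsto_pow_mul_exp_neg_atTop_nhds_zero 1).comp
        (mass_tend w hc hw_one)).const_mul K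
    refine squeeze_zero_norm (fun ν => ?_) h2
    show ‖(∫ x, g x ∂(ν.1 : Measure (OnePoint ℝ))) * Real.exp (-(ν.1.mass : ℝ))‖ ≤ _
    rw [norm_mul, Real.norm_of_nonneg (Real.exp_pos _).le, pow_one, ← mul_assoc]
    gcongr
    exact norm_integral_le_of_norm_le_const (Eventually.of_forall hK)

theorem T_int (w : ℝ → ℝ) (hwc : Continuous w) (hw_one : ∀ x, 1 ≤ w x) (μ : Measure ℝ)
    (ν : Measure (OnePoint ℝ))
    (h : ν = (μ.withDensity (fun x => ENNReal.ofReal (w x))).map OnePoint.some)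
    (g : OnePoint ℝ → ℝ) (hg : Continuous g) :
    ∫ x, g x ∂ν = ∫ x, w x * g (x : OnePoint ℝ) ∂μ := by
  have hs : Measurable (OnePoint.some : ℝ → OnePoint ℝ) := OnePoint.continuous_coe.measurable
  rw [h, integral_map hs.aemeasurable hg.aestronglyMeasurable,
    integral_withDensity_eq_integral_toReal_smul (by fun_prop) (by simp)]
  refine integral_congr_ae (Eventually.of_forall fun x => ?_)
  simp only [smul_eq_mul]
  rw [ENNReal.toReal_ofReal (by linarith [hw_one x])]

/-- test family -/
def fam (a : ℝ) (z : OnePoint ℝ) : FiniteMeasure (OnePoint ℝ) :=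
  ⟨ENNReal.ofReal a • Measure.dirac ((0 : ℝ) : OnePoint ℝ) + Measure.dirac z, by
    have : IsFiniteMeasure (ENNReal.ofReal a • Measure.dirac ((0 : ℝ) : OnePoint ℝ)) :=
      Measure.smul_finite _ (by simp)
    infer_instance⟩

theorem fam_int (a : ℝ) (ha : 0 ≤ a) (z : OnePoint ℝ) (g : OnePoint ℝ → ℝ) (hg : Continuous g) :
    ∫ x, g x ∂(fam a z : Measure (OnePoint ℝ)) = a * g (0 : ℝ) + g z := by
  show ∫ x, g x ∂(ENNReal.ofReal a • Measure.dirac ((0 : ℝ) : OnePoint ℝ) + Measure.dirac z) = _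
  rw [integral_add_measure ((int_able g hg _).smul_measure (by simp)) (int_able g hg _),
    integral_smul_measure, integral_dirac' _ _ hg.stronglyMeasurable,
    integral_dirac' _ _ hg.stronglyMeasurable, ENNReal.toReal_ofReal ha, smul_eq_mul]

theorem fam_T (w : ℝ → ℝ) (hwc : Continuous w) (hw_one : ∀ x, 1 ≤ w x) (x : ℝ) :
    (fam (w 0 * (1 - (w x)⁻¹)) (x : OnePoint ℝ) : Measure (OnePoint ℝ)) =
      ((ENNReal.ofReal (1 - (w x)⁻¹) • Measure.dirac 0 +
        ENNReal.ofReal (w x)⁻¹ • Measure.dirac x : Measure ℝ).withDensity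
          (fun x => ENNReal.ofReal (w x))).map OnePoint.some := by
  have hs : Measurable (OnePoint.some : ℝ → OnePoint ℝ) := OnePoint.continuous_coe.measurable
  have hd : ∀ y : ℝ, (Measure.dirac y).withDensity (fun x => ENNReal.ofReal (w x)) =
      ENNReal.ofReal (w y) • Measure.dirac y := by
    intro y
    ext s hs
    classical
    rw [withDensity_apply _ hs, restrict_dirac' hs]
    by_cases h : y ∈ s <;> simp [h, hs]
  rw [withDensity_add_measure, withDensity_smul_measure, withDensity_smul_measure, hd, hd,
    Measure.map_add _ _ hs, Measure.map_smul, Measure.map_smul, Measure.map_smul,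
    Measure.map_smul, Measure.map_dirac' hs, Measure.map_dirac' hs, smul_smul, smul_smul,
    ← ENNReal.ofReal_mul (sub_nonneg.2 (inv_le_one_of_one_le₀ (hw_one x))),
    ← ENNReal.ofReal_mul (inv_nonneg.2 (by linarith [hw_one x])),
    inv_mul_cancel₀ (by linarith [hw_one x]), mul_comm (1 - (w x)⁻¹)]
  simp [fam]

theorem stmt_6 (w : ℝ → ℝ)
    (hw_smooth : ContDiff ℝ (⊤ : ℕ∞) w) (hw_one : ∀ x, 1 ≤ w x)
    (hw_infty : Tendsto w (cocompact ℝ) atTop)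
    (φ : ℝ → ℝ) (hφ : Continuous φ) :
    (∃ F : C₀(XSp w, ℝ),
      ∀ μ : Measure ℝ, IsProbabilityMeasure μ → Integrable w μ →
        ∀ ν : XSp w,
          (ν.1 : Measure (OnePoint ℝ)) =
            (μ.withDensity (fun x => ENNReal.ofReal (w x))).map OnePoint.some →
          F ν = (∫ x, φ x ∂μ) * Real.exp (-(∫ x, w x ∂μ)))
    ↔ ∃ l : ℝ, Tendsto (fun x => φ x / w x) (cocompact ℝ) (𝓝 l) := by
  have hwc : Continuous w := hw_smooth.continuous
  have hc := winv_cont w hwc hw_one hw_infty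
  have hw0 : ∀ x, w x ≠ 0 := fun x => by linarith [hw_one x]
  constructor
  · rintro ⟨F, hF⟩
    have hi : ∀ z, 0 ≤ w 0 * (1 - winvOP w z) := fun z =>
      mul_nonneg (by linarith [hw_one 0]) (sub_nonneg.2 (winv_le w hw_one z))
    let N : OnePoint ℝ → XSp w := fun z => ⟨fam (w 0 * (1 - winvOP w z)) z, by
      rw [XSp_iff w hc hw_one, fam_int _ (hi z) _ _ hc]
      have : winvOP w ((0:ℝ) : OnePoint ℝ) = (w 0)⁻¹ := rfl
      rw [this]
      field_simp [hw0 0]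
      ring⟩
    have hN : Continuous N := by
      refine Continuous.subtype_mk ?_ _
      rw [continuous_iff_continuousAt]
      intro z
      refine FiniteMeasure.tendsto_of_forall_integral_tendsto fun g => ?_
      simp_rw [fun y => fam_int _ (hi y) y g g.continuous]
      have : Continuous fun y => w 0 * (1 - winvOP w y) * g ((0:ℝ) : OnePoint ℝ) + g y := by
        fun_prop
      exact this.tendsto z
    have hG : Tendsto (fun x : ℝ => F (N x)) (cocompact ℝ) (𝓝 (F (N OnePoint.infty))) := by
      rw [← Filter.coclosedCompact_eq_cocompact]
      exact ((F.continuous.comp hN).tendsto _).comp OnePoint.tendsto_coe_infty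
    have hI : Tendsto (fun x : ℝ => (w x)⁻¹) (cocompact ℝ) (𝓝 0) :=
      tendsto_inv_atTop_zero.comp hw_infty
    have hval : ∀ x : ℝ, F (N x) = ((1 - (w x)⁻¹) * φ 0 + (w x)⁻¹ * φ x) *
        Real.exp (-((1 - (w x)⁻¹) * w 0 + 1)) := by
      intro x
      have h1 : 0 ≤ 1 - (w x)⁻¹ := sub_nonneg.2 (inv_le_one_of_one_le₀ (hw_one x))
      have h2 : 0 ≤ (w x)⁻¹ := inv_nonneg.2 (by linarith [hw_one x])
      have hint : ∀ (g : ℝ → ℝ) (y : ℝ) (c : ℝ), Continuous g →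
          Integrable g (ENNReal.ofReal c • Measure.dirac y) := fun g y c hg =>
        (integrable_dirac' hg.stronglyMeasurable (by simp)).smul_measure (by simp)
      have hval : ∀ g : ℝ → ℝ, Continuous g →
          ∫ y, g y ∂(ENNReal.ofReal (1 - (w x)⁻¹) • Measure.dirac 0 +
            ENNReal.ofReal (w x)⁻¹ • Measure.dirac x : Measure ℝ) =
            (1 - (w x)⁻¹) * g 0 + (w x)⁻¹ * g x := by
        intro g hg
        rw [integral_add_measure (hint g _ _ hg) (hint g _ _ hg), integral_smul_measure,
          integral_smul_measure, integral_dirac, integral_dirac, ENNReal.toReal_ofReal h1,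
          ENNReal.toReal_ofReal h2, smul_eq_mul, smul_eq_mul]
      have := hF (ENNReal.ofReal (1 - (w x)⁻¹) • Measure.dirac 0 +
        ENNReal.ofReal (w x)⁻¹ • Measure.dirac x) ⟨by
          simp [← ENNReal.ofReal_add h1 h2]⟩
          ((hint w _ _ hwc).add_measure (hint w _ _ hwc)) (N x) (fam_T w hwc hw_one x)
      rw [this, hval φ hφ, hval w hwc, inv_mul_cancel₀ (hw0 x)]
    have hlim := (hG.mul (Real.continuous_exp.continuousAt.tendsto.comp
      (((tendsto_const_nhds (x := (1:ℝ))).sub hI |>.mul_const (w 0)).add_const 1))).sub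
      (((tendsto_const_nhds (x := (1:ℝ))).sub hI).mul_const (φ 0))
    refine ⟨_, hlim.congr fun x => ?_⟩
    simp only [Function.comp]
    rw [hval x, mul_assoc, ← Real.exp_add, neg_add_cancel, Real.exp_zero, div_eq_mul_inv]
    ring
  · rintro ⟨l, hl⟩
    have hg := opExt_cont (fun x => φ x / w x) (hφ.div hwc hw0) l hl
    obtain ⟨F, hF⟩ := exF w hc hw_one _ hg
    refine ⟨F, fun μ _ _ ν hν => ?_⟩
    have e1 := T_int w hwc hw_one μ _ hν _ hg
    have e2 := T_int w hwc hw_one μ _ hν (fun _ => 1) continuous_const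
    have e3 : ∀ x, w x * (((x : OnePoint ℝ).elim l (fun x => φ x / w x)) : ℝ) = φ x :=
      fun x => mul_div_cancel₀ _ (hw0 x)
    rw [integral_congr_ae (Eventually.of_forall e3)] at e1
    rw [hF, e1]
    congr 3
    simp only [integral_const, smul_eq_mul, mul_one] at e2
    exact e2
end
end
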